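/- Let $k$ be a field and $g\ge 3$. The homogeneous coordinate ring $A$ of the hyperelliptic ribbon, i.e., $k[u_0,\dots,u_{g-1},v_0,\dots,v_{g-3}]$ modulo the relations $u_iu_j=u_ku_l$, $u_iv_j=u_kv_l$ (for $i+j=k+l$) and $v_iv_j=0$, with all generators in degree 1, is a Koszul algebra. -/

import Mathlib

open MvPolynomial

noncomputable section

/-- Variables `u₀,…,u_{g-1}, v₀,…,v_{g-3}`. -/
abbrev RibVar (g : ℕ) := Fin g ⊕ Fin (g - 2)

abbrev Ugen (k : Type*) [Field k] {g : ℕ} (i : Fin g) : MvPolynomial (RibVar g) k :=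
  X (Sum.inl i)
abbrev Vgen (k : Type*) [Field k] {g : ℕ} (j : Fin (g - 2)) : MvPolynomial (RibVar g) k :=
  X (Sum.inr j)

/-- The defining quadratic relations of the hyperelliptic ribbon algebra, all generators
placed in degree 1: `uᵢuⱼ - u_k u_l`, `uᵢvⱼ - u_k v_l` for `i+j = k+l`, and `vᵢvⱼ`. -/
def ribRels (k : Type*) [Field k] (g : ℕ) : Set (MvPolynomial (RibVar g) k) :=
  {f | ∃ i j l m : Fin g, (i : ℕ) + (j : ℕ) = (l : ℕ) + (m : ℕ) ∧
        f = Ugen k i * Ugen k j - Ugen k l * Ugen k m} ∪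
  {f | ∃ i l : Fin g, ∃ j m : Fin (g - 2), (i : ℕ) + (j : ℕ) = (l : ℕ) + (m : ℕ) ∧
        f = Ugen k i * Vgen k j - Ugen k l * Vgen k m} ∪
  {f | ∃ j m : Fin (g - 2), f = Vgen k j * Vgen k m}

/-- The homogeneous coordinate ring of the hyperelliptic ribbon,
with all generators in degree 1. -/
abbrev RibAlg (k : Type*) [Field k] (g : ℕ) :=
  MvPolynomial (RibVar g) k ⧸ Ideal.span (ribRels k g)

/-- The degree-1 part of `RibAlg`: the image of the linear forms. -/
def deg1 (k : Type*) [Field k] (g : ℕ) : Submodule k (RibAlg k g) :=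
  Submodule.map (Ideal.Quotient.mkₐ k (Ideal.span (ribRels k g))).toLinearMap
    (MvPolynomial.homogeneousSubmodule (RibVar g) k 1)

/-- The augmentation ideal of `RibAlg` (generated by the images of the variables). -/
def augIdeal (k : Type*) [Field k] (g : ℕ) : Ideal (RibAlg k g) :=
  Ideal.span (Set.range fun w : RibVar g =>
    Ideal.Quotient.mk (Ideal.span (ribRels k g)) (X w))

section KoszulFlag

variable {A : Type*} [CommRing A]

/-- The ideal generated by the first `i` elements of the flag. -/
def flagIdeal (x : ℕ → A) (i : ℕ) : Ideal A := Ideal.span (x '' Set.Iio i)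

/-- A matrix with entries in `L` whose columns have flag colon ideals. -/
def GoodMat (L : Set A) (r : ℕ) (x : ℕ → A) {m n : ℕ} (D : Matrix (Fin m) (Fin n) A) : Prop :=
  (∀ i j, D i j ∈ L) ∧ ∃ e : Fin n → ℕ, (∀ j, e j ≤ r) ∧
    ∀ j (f : A), f • D.col j ∈ Submodule.span A (D.col '' Set.Iio j) ↔ f ∈ flagIdeal x (e j)

theorem mem_flagIdeal_iff (x : ℕ → A) (i : ℕ) (f : A) :
    f ∈ flagIdeal x i ↔ ∃ h : Fin i → A, f = ∑ q, h q * x q := by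
  have : x '' Set.Iio i = Set.range (fun q : Fin i => x q) := by
    ext y; constructor
    · rintro ⟨q, hq, rfl⟩; exact ⟨⟨q, hq⟩, rfl⟩
    · rintro ⟨q, rfl⟩; exact ⟨q, q.2, rfl⟩
  rw [flagIdeal, this, Ideal.span, Submodule.mem_span_range_iff_exists_fun]
  simp only [smul_eq_mul, eq_comm]

theorem mulVec_eq_sum_col {m n : ℕ} (D : Matrix (Fin m) (Fin n) A) (a : Fin n → A) :
    D.mulVec a = ∑ i, a i • D.col i := by
  ext q
  simp [Matrix.mulVec, dotProduct, Finset.sum_apply, mul_comm]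

theorem exists_coeff {m n : ℕ} (D : Matrix (Fin m) (Fin n) A) (j : Fin n) (y : Fin m → A)
    (hy : y ∈ Submodule.span A (D.col '' Set.Iio j)) :
    ∃ a : Fin n → A, (∀ i, j ≤ i → a i = 0) ∧ y = D.mulVec a := by
  induction hy using Submodule.span_induction with
  | mem y hy =>
    obtain ⟨i, hi, rfl⟩ := hy
    refine ⟨Pi.single i 1, ?_, by simp⟩
    intro i' hi'
    have : i' ≠ i := fun h => by subst h; exact absurd hi (not_lt.2 hi')
    simp [this]
  | zero => exact ⟨0, by simp, by simp⟩
  | add y z _ _ h1 h2 =>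
    obtain ⟨a, ha, rfl⟩ := h1
    obtain ⟨b, hb, rfl⟩ := h2
    exact ⟨a + b, fun i hi => by simp [ha i hi, hb i hi], by rw [Matrix.mulVec_add]⟩
  | smul c y _ h1 =>
    obtain ⟨a, ha, rfl⟩ := h1
    exact ⟨c • a, fun i hi => by simp [ha i hi], by rw [Matrix.mulVec_smul]⟩

theorem goodMat_step (L : AddSubgroup A) (r : ℕ) (x : ℕ → A) (c : ℕ → ℕ)
    (p1 p2 : A →+ A) (hp1 : ∀ a, p1 a ∈ L)
    (hp2 : ∀ a, ∀ y ∈ L, p2 (a * y) = p1 a * y)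
    (hp3 : ∀ y ∈ L, p1 y = y)
    (hx : ∀ i < r, x i ∈ L)
    (hc : ∀ i < r, c i ≤ r ∧ ∀ f, f * x i ∈ flagIdeal x i ↔ f ∈ flagIdeal x (c i))
    {m n : ℕ} (D : Matrix (Fin m) (Fin n) A) (hD : GoodMat (L : Set A) r x D) :
    ∃ (n' : ℕ) (D' : Matrix (Fin n) (Fin n') A), GoodMat (L : Set A) r x D' ∧
      LinearMap.range D'.mulVecLin = LinearMap.ker D.mulVecLin := by
  obtain ⟨hDL, e, her, hcol⟩ := hD
  have key : ∀ (j : Fin n) (q : Fin (e j)), ∃ s : Fin n → A,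
      (∀ i, s i ∈ L) ∧ s j = x q ∧ (∀ i, j < i → s i = 0) ∧ D.mulVec s = 0 := by
    intro j q
    have hq : (q : ℕ) < r := q.2.trans_le (her j)
    have h1 : x q • D.col j ∈ Submodule.span A (D.col '' Set.Iio j) :=
      (hcol j _).2 (Ideal.subset_span ⟨q, q.2, rfl⟩)
    obtain ⟨a, ha, hya⟩ := exists_coeff D j _ h1
    have h2 : x q • D.col j = D.mulVec (fun i => p1 (a i)) := by
      ext t
      have := congrFun hya t
      have h3 := congrArg p2 this
      simp only [Matrix.mulVec, dotProduct, map_sum, Pi.smul_apply, smul_eq_mul,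
        Matrix.col_apply] at h3 ⊢
      rw [hp2 _ _ (hDL t j), hp3 _ (hx _ hq)] at h3
      rw [h3]
      refine Finset.sum_congr rfl fun i _ => ?_
      rw [mul_comm (D t i), hp2 _ _ (hDL t i), mul_comm]
    refine ⟨fun i => (Pi.single j (x q) : Fin n → A) i - p1 (a i), ?_, ?_, ?_, ?_⟩
    · intro i
      refine L.sub_mem ?_ (hp1 _)
      by_cases h : i = j
      · subst h; simpa using hx _ hq
      · simp [h, L.zero_mem]
    · simp [ha j le_rfl]
    · intro i hi
      simp [ha i hi.le, hi.ne']
    · have : (fun i => (Pi.single j (x q) : Fin n → A) i - p1 (a i))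
          = Pi.single j (x q) - fun i => p1 (a i) := rfl
      rw [this, Matrix.mulVec_sub, ← h2]
      ext t; simp
  choose s hsL hsj hs0 hsD using key
  have claim1 : ∀ (j0 : ℕ) (z : Fin n → A), D.mulVec z = 0 → (∀ i : Fin n, j0 ≤ i → z i = 0) →
      z ∈ Submodule.span A {w | ∃ (j : Fin n) (q : Fin (e j)), (j : ℕ) < j0 ∧ w = s j q} := by
    intro j0
    induction j0 with
    | zero =>
      intro z _ hz
      have : z = 0 := funext fun i => hz i (Nat.zero_le _)
      rw [this]; exact Submodule.zero_mem _
    | succ j0 ih =>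
      intro z hz hz0
      have mono : Submodule.span A {w | ∃ (j : Fin n) (q : Fin (e j)), (j : ℕ) < j0 ∧ w = s j q} ≤
          Submodule.span A {w | ∃ (j : Fin n) (q : Fin (e j)), (j : ℕ) < j0 + 1 ∧ w = s j q} := by
        apply Submodule.span_mono
        rintro w ⟨j, q, h, rfl⟩
        exact ⟨j, q, by omega, rfl⟩
      by_cases hj : j0 < n
      · set j : Fin n := ⟨j0, hj⟩ with hjdef
        have h1 : z j • D.col j ∈ Submodule.span A (D.col '' Set.Iio j) := by
          rw [mulVec_eq_sum_col, ← Finset.add_sum_erase _ _ (Finset.mem_univ j)] at hz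
          rw [eq_neg_of_add_eq_zero_left hz]
          refine Submodule.neg_mem _ (Submodule.sum_mem _ fun i hi => ?_)
          have hij : i ≠ j := Finset.ne_of_mem_erase hi
          by_cases hlt : i < j
          · exact Submodule.smul_mem _ _ (Submodule.subset_span ⟨i, hlt, rfl⟩)
          · have : z i = 0 := by
              apply hz0
              have h2 : j < i := lt_of_le_of_ne (not_lt.1 hlt) hij.symm
              exact h2
            rw [this, zero_smul]; exact Submodule.zero_mem _
        rw [hcol, mem_flagIdeal_iff] at h1
        obtain ⟨h, hh⟩ := h1
        have h4 : z - ∑ q, h q • s j q ∈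
            Submodule.span A {w | ∃ (j : Fin n) (q : Fin (e j)), (j : ℕ) < j0 ∧ w = s j q} := by
          apply ih
          · rw [Matrix.mulVec_sub, hz, Matrix.mulVec_sum]
            simp [Matrix.mulVec_smul, hsD]
          · intro i hi
            simp only [Pi.sub_apply, Finset.sum_apply, Pi.smul_apply, smul_eq_mul]
            rcases hi.eq_or_lt with h5 | h5
            · have : i = j := Fin.ext h5.symm
              rw [this, hh, sub_eq_zero]
              exact Finset.sum_congr rfl fun q _ => by rw [hsj]
            · rw [hz0 i h5]
              have : ∀ q, s j q i = 0 := fun q => hs0 j q i h5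
              simp [this]
        have h6 : z = (z - ∑ q, h q • s j q) + ∑ q, h q • s j q := by abel
        rw [h6]
        refine Submodule.add_mem _ (mono h4) (Submodule.sum_mem _ fun q _ =>
          Submodule.smul_mem _ _ (Submodule.subset_span ⟨j, q, ?_, rfl⟩))
        simp [hjdef]
      · exact mono (ih z hz fun i hi => absurd i.2 (by omega))
  have claim2 : ∀ (j : Fin n) (q : Fin (e j)) (f : A), f • s j q ∈ Submodule.span A
      ({w | ∃ (j' : Fin n) (q' : Fin (e j')), j' < j ∧ w = s j' q'} ∪
        {w | ∃ q' : Fin (e j), q' < q ∧ w = s j q'}) ↔ f ∈ flagIdeal x (c q) := by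
    intro j q f
    rw [← (hc _ (q.2.trans_le (her _))).2]
    constructor
    · intro hf
      have h1 := Submodule.mem_map_of_mem (f := (LinearMap.proj j : (Fin n → A) →ₗ[A] A)) hf
      rw [Submodule.map_span] at h1
      simp only [LinearMap.proj_apply, Pi.smul_apply, smul_eq_mul, hsj] at h1
      refine Submodule.span_le.2 ?_ h1
      rintro _ ⟨w, ⟨j', q', hj', rfl⟩ | ⟨q', hq', rfl⟩, rfl⟩
      · simp [hs0 _ _ _ hj']
      · simp only [LinearMap.proj_apply, hsj]
        exact Ideal.subset_span ⟨q', hq', rfl⟩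
    · intro hf
      rw [mem_flagIdeal_iff] at hf
      obtain ⟨h, hh⟩ := hf
      let ι : Fin q → Fin (e j) := fun q' => ⟨q', q'.2.trans q.2⟩
      have h4 : f • s j q - ∑ q', h q' • s j (ι q') ∈
          Submodule.span A {w | ∃ (j' : Fin n) (q : Fin (e j')), (j' : ℕ) < j ∧ w = s j' q} := by
        apply claim1
        · rw [Matrix.mulVec_sub, Matrix.mulVec_sum]
          simp [Matrix.mulVec_smul, hsD]
        · intro i hi
          simp only [Pi.sub_apply, Finset.sum_apply, Pi.smul_apply, smul_eq_mul]
          rcases hi.eq_or_lt with h5 | h5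
          · have : i = j := Fin.ext h5.symm
            rw [this, hsj, hh, sub_eq_zero]
            exact Finset.sum_congr rfl fun q _ => by rw [hsj]
          · have : ∀ q, s j q i = 0 := fun q => hs0 j q i h5
            simp [this]
      have h6 : f • s j q = (f • s j q - ∑ q', h q' • s j (ι q')) + ∑ q', h q' • s j (ι q') := by
        abel
      rw [h6]
      refine Submodule.add_mem _ (Submodule.span_mono ?_ h4) (Submodule.sum_mem _ fun q' _ =>
          Submodule.smul_mem _ _ (Submodule.subset_span (Or.inr ⟨ι q', q'.2, rfl⟩)))
      rintro w ⟨j', q', hj', rfl⟩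
      exact Or.inl ⟨j', q', hj', rfl⟩
  let o : Fin (Fintype.card (Σₗ j : Fin n, Fin (e j))) ≃o (Σₗ j : Fin n, Fin (e j)) :=
    Fintype.orderIsoFinOfCardEq _ rfl
  let D' : Matrix (Fin n) (Fin (Fintype.card (Σₗ j : Fin n, Fin (e j)))) A :=
    fun i t => s (ofLex (o t)).1 (ofLex (o t)).2 i
  have hD'col : ∀ t, D'.col t = s (ofLex (o t)).1 (ofLex (o t)).2 := fun t => rfl
  refine ⟨_, D', ⟨fun i t => hsL _ _ _, fun t => c (ofLex (o t)).2, ?_, ?_⟩, ?_⟩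
  · intro t
    exact (hc _ ((ofLex (o t)).2.2.trans_le (her _))).1
  · intro t f
    rw [hD'col, ← claim2]
    have : D'.col '' Set.Iio t =
      ({w | ∃ (j' : Fin n) (q' : Fin (e j')), j' < (ofLex (o t)).1 ∧ w = s j' q'} ∪
        {w | ∃ q' : Fin (e (ofLex (o t)).1), q' < (ofLex (o t)).2 ∧
          w = s (ofLex (o t)).1 q'}) := by
      ext w
      constructor
      · rintro ⟨t', ht', rfl⟩
        have h1 : o t' < o t := o.lt_iff_lt.2 ht'
        rw [hD'col]
        generalize o t' = y' at h1 ⊢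
        generalize o t = y at h1 ⊢
        rcases h1 with ⟨a', a, h⟩ | ⟨a', a, h⟩
        · exact Or.inl ⟨_, _, h, rfl⟩
        · exact Or.inr ⟨_, h, rfl⟩
      · rintro (⟨j', q', h, rfl⟩ | ⟨q', h, rfl⟩)
        · refine ⟨o.symm (toLex ⟨j', q'⟩), ?_, ?_⟩
          · rw [Set.mem_Iio, OrderIso.symm_apply_lt]
            exact Sigma.Lex.left _ _ h
          · rw [hD'col, o.apply_symm_apply]; rfl
        · refine ⟨o.symm (toLex ⟨_, q'⟩), ?_, ?_⟩
          · rw [Set.mem_Iio, OrderIso.symm_apply_lt]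
            exact Sigma.Lex.right _ _ h
          · rw [hD'col, o.apply_symm_apply]; rfl
    rw [this]
  · apply le_antisymm
    · rintro _ ⟨a, rfl⟩
      rw [Matrix.mulVecLin_apply, mulVec_eq_sum_col]
      refine Submodule.sum_mem _ fun t _ => Submodule.smul_mem _ _ ?_
      rw [hD'col, LinearMap.mem_ker, Matrix.mulVecLin_apply, hsD]
    · intro z hz
      rw [LinearMap.mem_ker, Matrix.mulVecLin_apply] at hz
      have h1 := claim1 n z hz fun i hi => absurd i.2 (by omega)
      refine Submodule.span_le.2 ?_ h1
      rintro w ⟨j, q, -, rfl⟩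
      refine ⟨Pi.single (o.symm (toLex ⟨j, q⟩)) 1, ?_⟩
      rw [Matrix.mulVecLin_apply, Matrix.mulVec_single_one, hD'col, o.apply_symm_apply]
      rfl


theorem exists_resolution (L : AddSubgroup A) (r : ℕ) (x : ℕ → A) (c : ℕ → ℕ)
    (p1 p2 : A →+ A) (hp1 : ∀ a, p1 a ∈ L)
    (hp2 : ∀ a, ∀ y ∈ L, p2 (a * y) = p1 a * y)
    (hp3 : ∀ y ∈ L, p1 y = y)
    (hx : ∀ i < r, x i ∈ L)
    (hc : ∀ i < r, c i ≤ r ∧ ∀ f, f * x i ∈ flagIdeal x i ↔ f ∈ flagIdeal x (c i)) :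
    ∃ (b : ℕ → ℕ) (d : (n : ℕ) → Matrix (Fin (b n)) (Fin (b (n + 1))) A),
      b 0 = 1 ∧
      (∀ n i j, d n i j ∈ L) ∧
      LinearMap.range (Matrix.mulVecLin (d 0)) =
        Submodule.pi Set.univ (fun _ : Fin (b 0) => (flagIdeal x r : Submodule A A)) ∧
      (∀ n, LinearMap.range (Matrix.mulVecLin (d (n + 1))) =
        LinearMap.ker (Matrix.mulVecLin (d n))) := by
  let D0 : Matrix (Fin 1) (Fin r) A := fun _ j => x j
  have hcolD0 : ∀ j, D0.col j = fun _ => x j := fun j => rfl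
  have himg : ∀ (S : Set (Fin r)) (f : A), (fun _ : Fin 1 => f) ∈ Submodule.span A (D0.col '' S) ↔
      f ∈ Ideal.span ((fun j : Fin r => x j) '' S) := by
    intro S f
    constructor
    · intro h
      have h1 := Submodule.mem_map_of_mem (f := (LinearMap.proj 0 : (Fin 1 → A) →ₗ[A] A)) h
      rw [Submodule.map_span, ← Set.image_comp] at h1
      exact h1
    · intro h
      have h1 := Submodule.mem_map_of_mem
        (f := (LinearMap.pi (fun _ => LinearMap.id) : A →ₗ[A] (Fin 1 → A))) h
      rw [Ideal.span, Submodule.map_span, ← Set.image_comp] at h1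
      exact h1
  have hflag : ∀ j : Fin r, (fun j : Fin r => x j) '' Set.Iio j = x '' Set.Iio (j : ℕ) := by
    intro j
    ext y; constructor
    · rintro ⟨q, hq, rfl⟩; exact ⟨q, hq, rfl⟩
    · rintro ⟨q, hq, rfl⟩; exact ⟨⟨q, lt_trans hq j.2⟩, hq, rfl⟩
  have hD0 : GoodMat (L : Set A) r x D0 := by
    refine ⟨fun i j => hx _ j.2, fun j => c j, fun j => (hc _ j.2).1, fun j f => ?_⟩
    rw [← (hc _ j.2).2, flagIdeal, ← hflag, ← himg]
    rfl
  have step := fun (m n : ℕ) (D : Matrix (Fin m) (Fin n) A) (hD : GoodMat (L : Set A) r x D) =>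
    goodMat_step L r x c p1 p2 hp1 hp2 hp3 hx hc D hD
  choose N' D' hD' hr using step
  let St := Σ (m n : ℕ), {D : Matrix (Fin m) (Fin n) A // GoodMat (L : Set A) r x D}
  let next : St → St := fun S => ⟨S.2.1, N' _ _ S.2.2.1 S.2.2.2, D' _ _ S.2.2.1 S.2.2.2, hD' _ _ _ _⟩
  let seq : ℕ → St := fun n => Nat.rec ⟨1, r, D0, hD0⟩ (fun _ S => next S) n
  refine ⟨fun n => (seq n).1, fun n => (seq n).2.2.1, rfl, fun n => (seq n).2.2.2.1, ?_,
    fun n => hr _ _ (seq n).2.2.1 (seq n).2.2.2⟩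
  change LinearMap.range D0.mulVecLin = Submodule.pi Set.univ (fun _ : Fin 1 => flagIdeal x r)
  ext y
  have hy : y = fun _ => y 0 := by ext i; rw [Subsingleton.elim i 0]
  rw [Matrix.range_mulVecLin, ← Set.image_univ, hy, himg]
  have : (fun j : Fin r => x j) '' Set.univ = x '' Set.Iio r := by
    ext y; constructor
    · rintro ⟨q, hq, rfl⟩; exact ⟨q, q.2, rfl⟩
    · rintro ⟨q, hq, rfl⟩; exact ⟨⟨q, hq⟩, trivial, rfl⟩
  rw [this]
  simp [Submodule.mem_pi, flagIdeal]

end KoszulFlag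

section Rib

variable (k : Type*) [Field k] (g : ℕ)

/-- The class of a variable. -/
def rgen (w : RibVar g) : RibAlg k g := Ideal.Quotient.mk (Ideal.span (ribRels k g)) (X w)

/-- `u_i`, extended by zero. -/
def ru (i : ℕ) : RibAlg k g := if h : i < g then rgen k g (Sum.inl ⟨i, h⟩) else 0

/-- `v_j`, extended by zero. -/
def rv (j : ℕ) : RibAlg k g := if h : j < g - 2 then rgen k g (Sum.inr ⟨j, h⟩) else 0

theorem rib_lift {B : Type*} [CommRing B] [Algebra k B] (U : ℕ → B) (V : ℕ → B)
    (h1 : ∀ i j l m, i < g → j < g → l < g → m < g → i + j = l + m → U i * U j = U l * U m)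
    (h2 : ∀ i j l m, i < g → j < g - 2 → l < g → m < g - 2 → i + j = l + m →
      U i * V j = U l * V m)
    (h3 : ∀ j m, j < g - 2 → m < g - 2 → V j * V m = 0) :
    ∃ F : RibAlg k g →ₐ[k] B, (∀ i < g, F (ru k g i) = U i) ∧ (∀ j < g - 2, F (rv k g j) = V j) := by
  let F0 : MvPolynomial (RibVar g) k →ₐ[k] B :=
    aeval (Sum.elim (fun i => U i) (fun j => V j))
  have hF0 : ∀ a ∈ Ideal.span (ribRels k g), F0 a = 0 := by
    intro a ha
    have : Ideal.span (ribRels k g) ≤ RingHom.ker F0 := by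
      rw [Ideal.span_le]
      rintro f ((⟨i, j, l, m, h, rfl⟩ | ⟨i, l, j, m, h, rfl⟩) | ⟨j, m, rfl⟩)
      · simp [F0, RingHom.mem_ker, h1 _ _ _ _ i.2 j.2 l.2 m.2 h]
      · simp [F0, RingHom.mem_ker, h2 _ _ _ _ i.2 j.2 l.2 m.2 h]
      · simp [F0, RingHom.mem_ker, h3 _ _ j.2 m.2]
    exact this ha
  refine ⟨Ideal.Quotient.liftₐ _ F0 hF0, ?_, ?_⟩
  · intro i hi
    rw [ru, dif_pos hi, rgen]
    change F0 _ = _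
    simp [F0]
  · intro i hi
    rw [rv, dif_pos hi, rgen]
    change F0 _ = _
    simp [F0]

theorem rib_ind {P : RibAlg k g → Prop} (h0 : ∀ a : k, P (algebraMap k _ a))
    (hadd : ∀ a b, P a → P b → P (a + b)) (hu : ∀ a, ∀ i < g, P a → P (a * ru k g i))
    (hv : ∀ a, ∀ j < g - 2, P a → P (a * rv k g j)) (a : RibAlg k g) : P a := by
  obtain ⟨p, rfl⟩ := Ideal.Quotient.mk_surjective a
  induction p using MvPolynomial.induction_on with
  | C a => exact h0 a
  | add p q hp hq => rw [map_add]; exact hadd _ _ hp hq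
  | mul_X p w hp =>
    rw [map_mul]
    rcases w with i | j
    · have := hu _ i i.2 hp
      rw [ru, dif_pos i.2] at this
      exact this
    · have := hv _ j j.2 hp
      rw [rv, dif_pos j.2] at this
      exact this

theorem ru_mul {i j l m : ℕ} (hi : i < g) (hj : j < g) (hl : l < g) (hm : m < g)
    (h : i + j = l + m) : ru k g i * ru k g j = ru k g l * ru k g m := by
  simp only [ru, dif_pos, hi, hj, hl, hm, rgen, ← map_mul]
  rw [Ideal.Quotient.eq]
  exact Ideal.subset_span (Or.inl (Or.inl ⟨_, _, _, _, h, rfl⟩))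

theorem ruv_mul {i j l m : ℕ} (hi : i < g) (hj : j < g - 2) (hl : l < g) (hm : m < g - 2)
    (h : i + j = l + m) : ru k g i * rv k g j = ru k g l * rv k g m := by
  simp only [ru, rv, dif_pos, hi, hj, hl, hm, rgen, ← map_mul]
  rw [Ideal.Quotient.eq]
  exact Ideal.subset_span (Or.inl (Or.inr ⟨_, _, _, _, h, rfl⟩))

theorem rv_mul (j m : ℕ) : rv k g j * rv k g m = 0 := by
  unfold rv
  split_ifs with hj hm
  · simp only [rgen, ← map_mul]
    rw [Ideal.Quotient.eq_zero_iff_mem]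
    exact Ideal.subset_span (Or.inr ⟨_, _, rfl⟩)
  all_goals simp

theorem deg1_eq_span : deg1 k g = Submodule.span k (Set.range (rgen k g)) := by
  rw [deg1, homogeneousSubmodule_one_eq_span_X, Submodule.map_span, ← Set.range_comp]
  rfl

theorem ru_mem_deg1 (i : ℕ) : ru k g i ∈ deg1 k g := by
  rw [deg1_eq_span]
  unfold ru
  split_ifs
  · exact Submodule.subset_span ⟨_, rfl⟩
  · exact Submodule.zero_mem _

theorem rv_mem_deg1 (i : ℕ) : rv k g i ∈ deg1 k g := by
  rw [deg1_eq_span]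
  unfold rv
  split_ifs
  · exact Submodule.subset_span ⟨_, rfl⟩
  · exact Submodule.zero_mem _

theorem rib_grading : ∃ p1 p2 : RibAlg k g →+ RibAlg k g, (∀ a, p1 a ∈ deg1 k g) ∧
    (∀ a, ∀ y ∈ deg1 k g, p2 (a * y) = p1 a * y) ∧ (∀ y ∈ deg1 k g, p1 y = y) := by
  obtain ⟨F, hFu, hFv⟩ := rib_lift k g (B := Polynomial (RibAlg k g))
    (fun i => Polynomial.C (ru k g i) * Polynomial.X)
    (fun j => Polynomial.C (rv k g j) * Polynomial.X)
    (by
      intro i j l m hi hj hl hm h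
      have := congrArg Polynomial.C (ru_mul k g hi hj hl hm h)
      rw [map_mul, map_mul] at this
      linear_combination (Polynomial.X ^ 2) * this)
    (by
      intro i j l m hi hj hl hm h
      have := congrArg Polynomial.C (ruv_mul k g hi hj hl hm h)
      rw [map_mul, map_mul] at this
      linear_combination (Polynomial.X ^ 2) * this)
    (by
      intro j m hj hm
      have := congrArg Polynomial.C (rv_mul k g j m)
      rw [map_mul, map_zero] at this
      linear_combination (Polynomial.X ^ 2) * this)
  have hF1 : ∀ y ∈ deg1 k g, F y = Polynomial.C y * Polynomial.X := by
    intro y hy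
    rw [deg1_eq_span] at hy
    induction hy using Submodule.span_induction with
    | mem y hy =>
      obtain ⟨w, rfl⟩ := hy
      rcases w with i | j
      · have := hFu i i.2
        rw [ru, dif_pos i.2] at this
        exact this
      · have := hFv j j.2
        rw [rv, dif_pos j.2] at this
        exact this
    | zero => simp
    | add y z _ _ h1 h2 => rw [map_add, h1, h2, map_add, add_mul]
    | smul c y _ h1 =>
      rw [map_smul, h1, ← smul_mul_assoc, Polynomial.smul_C]
  let co : ℕ → (RibAlg k g →+ RibAlg k g) := fun n =>
    (Polynomial.lcoeff (RibAlg k g) n).toAddMonoidHom.comp F.toRingHom.toAddMonoidHom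
  have hco : ∀ n a, co n a = (F a).coeff n := fun n a => rfl
  refine ⟨co 1, co 2, ?_, ?_, ?_⟩
  · intro a
    have : (∃ t : k, (F a).coeff 0 = algebraMap k _ t) ∧ (F a).coeff 1 ∈ deg1 k g := by
      have hmul : ∀ a, ∀ y ∈ deg1 k g,
          ((∃ t : k, (F a).coeff 0 = algebraMap k _ t) ∧ (F a).coeff 1 ∈ deg1 k g) →
          ((∃ t : k, (F (a * y)).coeff 0 = algebraMap k _ t) ∧
            (F (a * y)).coeff 1 ∈ deg1 k g) := by
        rintro a y hy ⟨⟨t, ht⟩, -⟩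
        rw [map_mul, hF1 y hy, ← mul_assoc]
        refine ⟨⟨0, by simp⟩, ?_⟩
        rw [Polynomial.coeff_mul_X, Polynomial.coeff_mul_C, ht, ← Algebra.smul_def]
        exact Submodule.smul_mem _ _ hy
      refine rib_ind k g (P := fun a => (∃ t : k, (F a).coeff 0 = algebraMap k _ t) ∧
        (F a).coeff 1 ∈ deg1 k g) ?_ ?_ ?_ ?_ a
      · intro t
        rw [AlgHom.commutes, Polynomial.algebraMap_apply]
        refine ⟨⟨t, by simp⟩, ?_⟩
        rw [Polynomial.coeff_C, if_neg one_ne_zero]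
        exact Submodule.zero_mem _
      · rintro a b ⟨⟨s, hs⟩, ha⟩ ⟨⟨t, ht⟩, hb⟩
        refine ⟨⟨s + t, by rw [map_add, Polynomial.coeff_add, hs, ht, map_add]⟩, ?_⟩
        rw [map_add, Polynomial.coeff_add]
        exact Submodule.add_mem _ ha hb
      · intro a i _ h
        exact hmul a _ (ru_mem_deg1 k g i) h
      · intro a i _ h
        exact hmul a _ (rv_mem_deg1 k g i) h
    exact this.2
  · intro a y hy
    rw [hco, hco, map_mul, hF1 y hy, ← mul_assoc, Polynomial.coeff_mul_X, Polynomial.coeff_mul_C]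
  · intro y hy
    rw [hco, hF1 y hy, Polynomial.coeff_mul_X, Polynomial.coeff_C_zero]

/-- The ideal of all `v`. -/
def vIdeal : Ideal (RibAlg k g) := Ideal.span (Set.range (rv k g))

/-- Standard monomials. -/
def stdMon : Set (RibAlg k g) :=
  {x | x = 1 ∨ ∃ a c i : ℕ, i < g ∧ x = ru k g 0 ^ a * ru k g i * ru k g (g - 1) ^ c}

theorem std_span (hg : 3 ≤ g) (a : RibAlg k g) :
    a ∈ Submodule.span k (stdMon k g) ⊔ (vIdeal k g).restrictScalars k := by
  refine rib_ind k g (P := fun a => a ∈ Submodule.span k (stdMon k g) ⊔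
    (vIdeal k g).restrictScalars k) ?_ ?_ ?_ ?_ a
  · intro t
    rw [Algebra.algebraMap_eq_smul_one]
    exact Submodule.smul_mem _ _ (Submodule.mem_sup_left (Submodule.subset_span (Or.inl rfl)))
  · intro a b ha hb
    exact Submodule.add_mem _ ha hb
  · intro a j hj ha
    obtain ⟨y, hy, z, hz, rfl⟩ := Submodule.mem_sup.1 ha
    rw [add_mul]
    refine Submodule.add_mem _ (Submodule.mem_sup_left ?_)
      (Submodule.mem_sup_right (Ideal.mul_mem_right _ _ hz))
    clear ha
    induction hy using Submodule.span_induction with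
    | mem y hy =>
      refine Submodule.subset_span ?_
      rcases hy with rfl | ⟨a, c, i, hi, rfl⟩
      · exact Or.inr ⟨0, 0, j, hj, by simp⟩
      · by_cases hij : i + j < g
        · refine Or.inr ⟨a + 1, c, i + j, hij, ?_⟩
          have := ru_mul k g hi hj (l := 0) (by omega) hij (by omega)
          linear_combination ru k g 0 ^ a * ru k g (g - 1) ^ c * this
        · refine Or.inr ⟨a, c + 1, i + j - (g - 1), by omega, ?_⟩
          have := ru_mul k g hi hj (l := i + j - (g - 1)) (m := g - 1) (by omega) (by omega)
            (by omega)
          linear_combination ru k g 0 ^ a * ru k g (g - 1) ^ c * this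
    | zero => simp
    | add y z _ _ h1 h2 => rw [add_mul]; exact Submodule.add_mem _ h1 h2
    | smul c y _ h1 => rw [smul_mul_assoc]; exact Submodule.smul_mem _ _ h1
  · intro a j hj ha
    exact Submodule.mem_sup_right (Ideal.mul_mem_left _ _ (Ideal.subset_span ⟨j, rfl⟩))

/-- normal form elements -/
def nfElt (n m : ℕ) : RibAlg k g :=
  if n ≤ m / (g - 1) then ru k g (g - 1) ^ n
  else ru k g 0 ^ (n - 1 - m / (g - 1)) * ru k g (m % (g - 1)) * ru k g (g - 1) ^ (m / (g - 1))

theorem nfElt_std (hg : 3 ≤ g) (a c i : ℕ) (hi : i < g) :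
    nfElt k g (a + c + 1) (i + (g - 1) * c) = ru k g 0 ^ a * ru k g i * ru k g (g - 1) ^ c := by
  have hpos : 0 < g - 1 := by omega
  unfold nfElt
  rw [Nat.add_mul_div_left _ _ hpos, Nat.add_mul_mod_self_left]
  by_cases h : i < g - 1
  · rw [Nat.div_eq_of_lt h, Nat.mod_eq_of_lt h, if_neg (by omega)]
    congr 2 <;> congr 1 <;> omega
  · have : i = g - 1 := by omega
    subst this
    rw [Nat.div_self hpos, Nat.mod_self]
    rcases a with _ | a
    · rw [if_pos (by omega)]
      rw [show 0 + c + 1 = c + 1 by omega]; ring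
    · rw [if_neg (by omega), show a + 1 + c + 1 - 1 - (1 + c) = a by omega]; ring

theorem rib_phi : ∃ F : RibAlg k g →ₐ[k] DualNumber (Polynomial (Polynomial k)),
    (∀ i < g, F (ru k g i) = TrivSqZeroExt.inl (Polynomial.C Polynomial.X * Polynomial.X ^ i)) ∧
    (∀ j < g - 2, F (rv k g j) =
      TrivSqZeroExt.inr (Polynomial.C Polynomial.X * Polynomial.X ^ j)) := by
  refine rib_lift k g (B := DualNumber (Polynomial (Polynomial k)))
    (fun i => TrivSqZeroExt.inl (Polynomial.C Polynomial.X * Polynomial.X ^ i))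
    (fun j => TrivSqZeroExt.inr (Polynomial.C Polynomial.X * Polynomial.X ^ j)) ?_ ?_ ?_
  · intro i j l m _ _ _ _ h
    rw [← TrivSqZeroExt.inl_mul, ← TrivSqZeroExt.inl_mul]
    congr 1
    rw [mul_mul_mul_comm, ← pow_add, h, pow_add, mul_mul_mul_comm]
  · intro i j l m _ _ _ _ h
    rw [TrivSqZeroExt.inl_mul_inr, TrivSqZeroExt.inl_mul_inr]
    congr 1
    rw [smul_eq_mul, smul_eq_mul, mul_mul_mul_comm, ← pow_add, h, pow_add, mul_mul_mul_comm]
  · intro j m _ _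
    exact TrivSqZeroExt.inr_mul_inr _ _ _

/-- Elements killed by the map to `k[s][t]` are in the ideal of the `v`. -/
theorem ker_phi (hg : 3 ≤ g) (F : RibAlg k g →ₐ[k] Polynomial (Polynomial k))
    (hFu : ∀ i < g, F (ru k g i) = Polynomial.C Polynomial.X * Polynomial.X ^ i)
    (hFv : ∀ j, F (rv k g j) = 0) (a : RibAlg k g) (ha : F a = 0) : a ∈ vIdeal k g := by
  let S : Polynomial (Polynomial k) →ₗ[k] RibAlg k g :=
    Polynomial.lsum fun m => Polynomial.lsum fun n =>
      LinearMap.toSpanSingleton k (RibAlg k g) (nfElt k g n m)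
  have hS : ∀ n m, S (Polynomial.C (Polynomial.X ^ n) * Polynomial.X ^ m) = nfElt k g n m := by
    intro n m
    simp only [S, Polynomial.lsum_apply]
    rw [Polynomial.C_mul_X_pow_eq_monomial, Polynomial.sum_monomial_index _ _ (by simp),
      Polynomial.X_pow_eq_monomial, Polynomial.sum_monomial_index _ _ (by simp)]
    simp
  have hFvI : ∀ y ∈ vIdeal k g, F y = 0 := by
    intro y hy
    have : vIdeal k g ≤ RingHom.ker F := by
      rw [vIdeal, Ideal.span_le]
      rintro _ ⟨j, rfl⟩
      exact hFv j
    exact this hy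
  have hstd : ∀ y ∈ Submodule.span k (stdMon k g), S (F y) = y := by
    intro y hy
    induction hy using Submodule.span_induction with
    | mem y hy =>
      rcases hy with rfl | ⟨a, c, i, hi, rfl⟩
      · have := hS 0 0
        simp only [pow_zero, map_one, mul_one] at this
        rw [map_one, this]
        simp [nfElt]
      · rw [map_mul F, map_mul F, map_pow F, map_pow F, hFu _ hi, hFu 0 (by omega), hFu (g-1) (by omega),
          ← nfElt_std k g hg a c i hi, ← hS]
        congr 1
        rw [map_pow, pow_add _ i, pow_mul]
        ring
    | zero => simp
    | add y z _ _ h1 h2 => rw [map_add, map_add, h1, h2]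
    | smul c y _ h1 => rw [map_smul, map_smul, h1]
  obtain ⟨y, hy, z, hz, rfl⟩ := Submodule.mem_sup.1 (std_span k g hg a)
  rw [map_add, hFvI z hz, add_zero] at ha
  have := hstd y hy
  rw [ha, map_zero] at this
  rw [← this, zero_add]
  exact hz

/-- The Koszul flag: `v_{g-3}, …, v_0, u_{g-1}, …, u_0`. -/
def ribFlag (i : ℕ) : RibAlg k g :=
  if i < g - 2 then rv k g (g - 3 - i) else ru k g (2 * g - 3 - i)

/-- The colon indices. -/
def ribColon (i : ℕ) : ℕ := if i = 0 ∨ i = g - 2 then g - 2 else 2 * g - 3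

theorem rv_mem_flag {i j : ℕ} (h : g - 3 < i + j) : rv k g j ∈ flagIdeal (ribFlag k g) i := by
  by_cases hj : j < g - 2
  · refine Ideal.subset_span ⟨g - 3 - j, ?_, ?_⟩
    · rw [Set.mem_Iio]; omega
    · rw [ribFlag, if_pos (by omega)]; congr 1; omega
  · rw [rv, dif_neg hj]; exact Ideal.zero_mem _

theorem ru_mem_flag (hg : 3 ≤ g) {i j : ℕ} (h : 2 * g - 3 < i + j) :
    ru k g j ∈ flagIdeal (ribFlag k g) i := by
  by_cases hj : j < g
  · refine Ideal.subset_span ⟨2 * g - 3 - j, ?_, ?_⟩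
    · rw [Set.mem_Iio]; omega
    · rw [ribFlag, if_neg (by omega)]; congr 1; omega
  · rw [ru, dif_neg hj]; exact Ideal.zero_mem _

theorem flag_v (hg : 3 ≤ g) : flagIdeal (ribFlag k g) (g - 2) = vIdeal k g := by
  apply le_antisymm
  · rw [flagIdeal, Ideal.span_le]
    rintro _ ⟨j, hj, rfl⟩
    rw [ribFlag, if_pos (Set.mem_Iio.1 hj)]
    exact Ideal.subset_span ⟨_, rfl⟩
  · rw [vIdeal, Ideal.span_le]
    rintro _ ⟨j, rfl⟩
    exact rv_mem_flag k g (by omega)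

theorem flag_top (hg : 3 ≤ g) : flagIdeal (ribFlag k g) (2 * g - 2) = augIdeal k g := by
  have hu : ∀ i, ru k g i ∈ augIdeal k g := by
    intro i
    unfold ru
    split_ifs
    · exact Ideal.subset_span ⟨_, rfl⟩
    · exact Ideal.zero_mem _
  have hv : ∀ i, rv k g i ∈ augIdeal k g := by
    intro i
    unfold rv
    split_ifs
    · exact Ideal.subset_span ⟨_, rfl⟩
    · exact Ideal.zero_mem _
  apply le_antisymm
  · rw [flagIdeal, Ideal.span_le]
    rintro _ ⟨j, hj, rfl⟩
    unfold ribFlag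
    split_ifs
    · exact hv _
    · exact hu _
  · rw [augIdeal, Ideal.span_le]
    rintro _ ⟨w, rfl⟩
    rcases w with i | j
    · have := ru_mem_flag k g hg (i := 2 * g - 2) (j := i) (by omega)
      rw [ru, dif_pos i.2] at this
      exact this
    · have := rv_mem_flag k g (i := 2 * g - 2) (j := j) (by omega)
      rw [rv, dif_pos j.2] at this
      exact this

theorem flag_mul_mem {A : Type*} [CommRing A] (x : ℕ → A) (n : ℕ) (y : A) (I : Ideal A)
    (h : ∀ j < n, x j * y ∈ I) (f : A) (hf : f ∈ flagIdeal x n) : f * y ∈ I := by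
  obtain ⟨a, rfl⟩ := (mem_flagIdeal_iff x n f).1 hf
  rw [Finset.sum_mul]
  refine Ideal.sum_mem _ fun q _ => ?_
  rw [mul_assoc]
  exact Ideal.mul_mem_left _ _ (h q q.2)

/-- Elements whose image in `k[s][t]` is divisible by `t` lie in the flag ideal omitting `u_0`. -/
theorem mem_flag_of_coeff (hg : 3 ≤ g) (F : RibAlg k g →ₐ[k] Polynomial (Polynomial k))
    (hFu : ∀ i < g, F (ru k g i) = Polynomial.C Polynomial.X * Polynomial.X ^ i)
    (hFv : ∀ j, F (rv k g j) = 0) (a : RibAlg k g) (ha : (F a).coeff 0 = 0) :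
    a ∈ flagIdeal (ribFlag k g) (2 * g - 3) := by
  have key : a - Polynomial.aeval (ru k g 0) ((F a).coeff 0) ∈
      flagIdeal (ribFlag k g) (2 * g - 3) := by
    refine rib_ind k g (P := fun a => a - Polynomial.aeval (ru k g 0) ((F a).coeff 0) ∈
      flagIdeal (ribFlag k g) (2 * g - 3)) ?_ ?_ ?_ ?_ a
    · intro t
      rw [AlgHom.commutes, Polynomial.algebraMap_apply, Polynomial.coeff_C_zero,
        AlgHom.commutes, sub_self]
      exact Ideal.zero_mem _
    · intro a b h1 h2
      rw [map_add, Polynomial.coeff_add, map_add, add_sub_add_comm]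
      exact Ideal.add_mem _ h1 h2
    · intro a i hi h
      rw [map_mul, hFu i hi, Polynomial.mul_coeff_zero, map_mul]
      rcases i with _ | i
      · simp only [pow_zero, mul_one, Polynomial.coeff_C_zero, Polynomial.aeval_X]
        rw [← sub_mul]
        exact Ideal.mul_mem_right _ _ h
      · have : (Polynomial.C (Polynomial.X : Polynomial k) * Polynomial.X ^ (i + 1)).coeff 0 = 0 := by
          simp
        rw [this, map_zero, mul_zero, sub_zero]
        exact Ideal.mul_mem_left _ _ (ru_mem_flag k g hg (by omega))
    · intro a j hj h
      rw [map_mul, hFv j, mul_zero, Polynomial.coeff_zero, map_zero, sub_zero]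
      exact Ideal.mul_mem_left _ _ (rv_mem_flag k g (by omega))
  rwa [ha, map_zero, sub_zero] at key

theorem coeff_of_dvd (P : Polynomial (Polynomial k)) (b : ℕ)
    (h : Polynomial.X ^ (b + 1) ∣ P * (Polynomial.C Polynomial.X * Polynomial.X ^ b)) :
    P.coeff 0 = 0 := by
  rw [Polynomial.X_pow_dvd_iff] at h
  have := h b (by omega)
  rw [← mul_assoc, Polynomial.coeff_mul_X_pow', if_pos le_rfl, Nat.sub_self,
    Polynomial.coeff_mul_C] at this
  exact (mul_eq_zero.1 this).resolve_right Polynomial.X_ne_zero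

theorem rib_colon (hg : 3 ≤ g) (i : ℕ) (hi : i < 2 * g - 2) (f : RibAlg k g) :
    f * ribFlag k g i ∈ flagIdeal (ribFlag k g) i ↔
      f ∈ flagIdeal (ribFlag k g) (ribColon g i) := by
  obtain ⟨G, hGu, hGv⟩ := rib_phi k g
  let F : RibAlg k g →ₐ[k] Polynomial (Polynomial k) :=
    (TrivSqZeroExt.fstHom k (Polynomial (Polynomial k)) (Polynomial (Polynomial k))).comp G
  have hF : ∀ a, F a = (G a).fst := fun a => rfl
  have hFu : ∀ i < g, F (ru k g i) = Polynomial.C Polynomial.X * Polynomial.X ^ i := by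
    intro i hi
    rw [hF, hGu i hi, TrivSqZeroExt.fst_inl]
  have hFv : ∀ j, F (rv k g j) = 0 := by
    intro j
    by_cases hj : j < g - 2
    · rw [hF, hGv j hj, TrivSqZeroExt.fst_inr]
    · rw [rv, dif_neg hj, map_zero]
  have hne : ∀ b : ℕ, (Polynomial.C (Polynomial.X : Polynomial k) * Polynomial.X ^ b) ≠ 0 := by
    intro b
    exact mul_ne_zero (Polynomial.C_ne_zero.2 Polynomial.X_ne_zero)
      (pow_ne_zero _ Polynomial.X_ne_zero)
  have hsnd : ∀ a, ∀ j < g - 2, (G (a * rv k g j)).snd =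
      F a * (Polynomial.C Polynomial.X * Polynomial.X ^ j) := by
    intro a j hj
    rw [map_mul, hGv j hj, hF]
    simp
  by_cases h0 : i = 0
  · subst h0
    rw [ribColon, if_pos (Or.inl rfl), flag_v k g hg, ribFlag, if_pos (by omega)]
    have hbot : flagIdeal (ribFlag k g) 0 = ⊥ := by simp [flagIdeal]
    rw [hbot, Ideal.mem_bot]
    constructor
    · intro h
      refine ker_phi k g hg F hFu hFv f ?_
      have h1 := hsnd f (g - 3 - 0) (by omega)
      rw [h, map_zero, TrivSqZeroExt.snd_zero] at h1
      exact (mul_eq_zero.1 h1.symm).resolve_right (hne _)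
    · intro h
      rw [← Ideal.mem_bot]
      rw [← flag_v k g hg] at h
      refine flag_mul_mem _ _ _ _ (fun j hj => ?_) f h
      rw [ribFlag, if_pos hj, rv_mul]
      exact Ideal.zero_mem _
  by_cases h2 : i = g - 2
  · subst h2
    rw [ribColon, if_pos (Or.inr rfl), flag_v k g hg, ribFlag, if_neg (by omega)]
    constructor
    · intro h
      refine ker_phi k g hg F hFu hFv f ?_
      have hle : vIdeal k g ≤ RingHom.ker F := by
        rw [vIdeal, Ideal.span_le]
        rintro _ ⟨j, rfl⟩
        exact hFv j
      have h1 : F _ = 0 := hle h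
      rw [map_mul, hFu _ (by omega)] at h1
      exact (mul_eq_zero.1 h1).resolve_right (hne _)
    · intro h
      exact Ideal.mul_mem_right _ _ h
  rw [ribColon, if_neg (by tauto)]
  by_cases h3 : i < g - 2
  · rw [show ribFlag k g i = rv k g (g - 3 - i) by rw [ribFlag, if_pos h3]]
    constructor
    · intro h
      refine mem_flag_of_coeff k g hg F hFu hFv f (coeff_of_dvd k _ (g - 3 - i) ?_)
      rw [← hsnd f _ (by omega)]
      obtain ⟨a, ha⟩ := (mem_flagIdeal_iff _ _ _).1 h
      rw [ha, map_sum, TrivSqZeroExt.snd_sum]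
      refine Finset.dvd_sum fun q _ => ?_
      rw [ribFlag, if_pos (q.2.trans h3), hsnd _ _ (by omega)]
      exact Dvd.dvd.mul_left (Dvd.dvd.mul_left (pow_dvd_pow _ (by omega)) _) _
    · refine flag_mul_mem _ _ _ _ (fun j hj => ?_) f
      unfold ribFlag
      split_ifs with hj2
      · rw [rv_mul]; exact Ideal.zero_mem _
      · rw [ruv_mul k g (l := 2 * g - 3 - j - 1) (m := g - 3 - i + 1) (by omega) (by omega)
          (by omega) (by omega) (by omega)]
        exact Ideal.mul_mem_left _ _ (rv_mem_flag k g (by omega))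
  · rw [show ribFlag k g i = ru k g (2 * g - 3 - i) by rw [ribFlag, if_neg h3]]
    constructor
    · intro h
      refine mem_flag_of_coeff k g hg F hFu hFv f (coeff_of_dvd k _ (2 * g - 3 - i) ?_)
      rw [← hFu _ (by omega), ← map_mul]
      obtain ⟨a, ha⟩ := (mem_flagIdeal_iff _ _ _).1 h
      rw [ha, map_sum]
      refine Finset.dvd_sum fun q _ => ?_
      rw [map_mul]
      refine Dvd.dvd.mul_left ?_ _
      unfold ribFlag
      split_ifs with hq
      · rw [hFv]; exact dvd_zero _
      · have := q.2
        rw [hFu _ (by omega)]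
        exact Dvd.dvd.mul_left (pow_dvd_pow _ (by omega)) _
    · refine flag_mul_mem _ _ _ _ (fun j hj => ?_) f
      rw [ribFlag]
      split_ifs with hj2
      · exact Ideal.mul_mem_right _ _ (rv_mem_flag k g (by omega))
      · rw [ru_mul k g (l := 2 * g - 3 - j - 1) (m := 2 * g - 3 - i + 1) (by omega) (by omega)
          (by omega) (by omega) (by omega)]
        exact Ideal.mul_mem_left _ _ (ru_mem_flag k g hg (by omega))

end Rib

set_option synthInstance.maxHeartbeats 1000000
set_option maxHeartbeats 2000000

/-- the hyperelliptic ribbon algebra `A = RibAlg k g` is Koszul: the residue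
field `k = A / A₊` admits a linear free resolution, i.e. a free resolution
`⋯ → A^{b₂} → A^{b₁} → A^{b₀} = A → k → 0` in which all the differentials are given by
matrices whose entries are homogeneous of degree 1. -/
theorem ribbon_algebra_koszul (k : Type*) [Field k] (g : ℕ) (hg : 3 ≤ g) :
    ∃ (b : ℕ → ℕ) (d : (n : ℕ) → Matrix (Fin (b n)) (Fin (b (n + 1))) (RibAlg k g)),
      b 0 = 1 ∧
      (∀ n i j, d n i j ∈ deg1 k g) ∧
      LinearMap.range (Matrix.mulVecLin (d 0)) =
        Submodule.pi Set.univ (fun _ : Fin (b 0) => (augIdeal k g : Submodule (RibAlg k g) (RibAlg k g))) ∧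
      (∀ n, LinearMap.range (Matrix.mulVecLin (d (n + 1))) =
        LinearMap.ker (Matrix.mulVecLin (d n))) := by
  obtain ⟨p1, p2, hp1, hp2, hp3⟩ := rib_grading k g
  have := exists_resolution (deg1 k g).toAddSubgroup (2 * g - 2) (ribFlag k g) (ribColon g)
    p1 p2 hp1 hp2 hp3
    (fun i _ => by
      unfold ribFlag
      split_ifs
      · exact rv_mem_deg1 k g _
      · exact ru_mem_deg1 k g _)
    (fun i hi => ⟨by unfold ribColon; split_ifs <;> omega, rib_colon k g hg i hi⟩)
  rw [flag_top k g hg] at this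
  exact this
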